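/- arXiv:2101.01041 — 4 statements merged into one kernel-verified Lean document; each statement's English description precedes it below -/
import Mathlib

section
/- Suppose K is admissible (K ∈ 𝒦). Then for every maximizer gain L = (L_t)_{t=0}^{N−1} and every t ∈ {0,…,N}, the value matrices satisfy P^{K,L}_t ⪯ P^K_t in the Loewner order; the inner maximizer attains this bound, i.e. P^{K,L(K)}_t = P^K_t for all t, so that G(K,L) ≤ G(K,L(K)) for all L; and L(K) is the unique maximizer of L ↦ G(K,L). -/
open Matrix

noncomputable section

/-- Rayleigh-quotient value set of a square real matrix. -/
def rayleighSet {a : ℕ} (M : Matrix (Fin a) (Fin a) ℝ) : Set ℝ :=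
  { r : ℝ | ∃ x : Fin a → ℝ, x ⬝ᵥ x = 1 ∧ r = x ⬝ᵥ M.mulVec x }

/-- Smallest eigenvalue (of a symmetric matrix), via the Rayleigh characterization. -/
def eigMin {a : ℕ} (M : Matrix (Fin a) (Fin a) ℝ) : ℝ := sInf (rayleighSet M)

/-- Largest eigenvalue (of a symmetric matrix), via the Rayleigh characterization. -/
def eigMax {a : ℕ} (M : Matrix (Fin a) (Fin a) ℝ) : ℝ := sSup (rayleighSet M)

/-- Operator (spectral) norm of a real matrix. -/
def opNorm {a b : ℕ} (M : Matrix (Fin a) (Fin b) ℝ) : ℝ := Real.sqrt (eigMax (Mᵀ * M))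

/-- Squared Frobenius norm. -/
def frobNormSq {a b : ℕ} (M : Matrix (Fin a) (Fin b) ℝ) : ℝ := ∑ i, ∑ j, (M i j) ^ 2

/-- Frobenius norm. -/
def frobNorm {a b : ℕ} (M : Matrix (Fin a) (Fin b) ℝ) : ℝ := Real.sqrt (frobNormSq M)

/-- Extend a finite tuple to a function on `ℕ` by zero. -/
def padZero {α : Type*} [Zero α] {N : ℕ} (f : Fin N → α) : ℕ → α :=
  fun t => if h : t < N then f ⟨t, h⟩ else 0

/-- Data of a finite-horizon zero-sum LQ dynamic game with horizon `N`. -/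
structure LQGame (m d n N : ℕ) where
  A : ℕ → Matrix (Fin m) (Fin m) ℝ
  B : ℕ → Matrix (Fin m) (Fin d) ℝ
  D : ℕ → Matrix (Fin m) (Fin n) ℝ
  Q : ℕ → Matrix (Fin m) (Fin m) ℝ
  QN : Matrix (Fin m) (Fin m) ℝ
  Ru : ℕ → Matrix (Fin d) (Fin d) ℝ
  Rw : ℕ → Matrix (Fin n) (Fin n) ℝ
  Sig : ℕ → Matrix (Fin m) (Fin m) ℝ
  hQ : ∀ t < N, (Q t).PosSemidef
  hQN : QN.PosSemidef
  hRu : ∀ t < N, (Ru t).PosDef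
  hRw : ∀ t < N, (Rw t).PosDef
  hSig : ∀ t ≤ N, (Sig t).PosDef

namespace LQGame

variable {m d n N : ℕ}

/-- Value matrices `P^{K,L}` indexed by the number `j` of steps before the terminal
time, i.e. `PKLaux g K L j = P^{K,L}_{N-j}`. -/
def PKLaux (g : LQGame m d n N) (K : ℕ → Matrix (Fin d) (Fin m) ℝ)
    (L : ℕ → Matrix (Fin n) (Fin m) ℝ) : ℕ → Matrix (Fin m) (Fin m) ℝ
  | 0 => g.QN
  | j + 1 =>
      (g.A (N - (j+1)) - g.B (N - (j+1)) * K (N - (j+1)) - g.D (N - (j+1)) * L (N - (j+1)))ᵀ *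
          PKLaux g K L j *
          (g.A (N - (j+1)) - g.B (N - (j+1)) * K (N - (j+1)) - g.D (N - (j+1)) * L (N - (j+1)))
        + g.Q (N - (j+1)) + (K (N - (j+1)))ᵀ * g.Ru (N - (j+1)) * K (N - (j+1))
        - (L (N - (j+1)))ᵀ * g.Rw (N - (j+1)) * L (N - (j+1))

/-- Value matrix `P^{K,L}_t`. -/
def PKL (g : LQGame m d n N) (K : ℕ → Matrix (Fin d) (Fin m) ℝ)
    (L : ℕ → Matrix (Fin n) (Fin m) ℝ) (t : ℕ) : Matrix (Fin m) (Fin m) ℝ :=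
  PKLaux g K L (N - t)

/-- Inner-loop Riccati matrices indexed by the number `j` of steps before the terminal
time, i.e. `PKaux g K j = P^K_{N-j}`. -/
def PKaux (g : LQGame m d n N) (K : ℕ → Matrix (Fin d) (Fin m) ℝ) :
    ℕ → Matrix (Fin m) (Fin m) ℝ
  | 0 => g.QN
  | j + 1 =>
      g.Q (N - (j+1)) + (K (N - (j+1)))ᵀ * g.Ru (N - (j+1)) * K (N - (j+1))
        + (g.A (N - (j+1)) - g.B (N - (j+1)) * K (N - (j+1)))ᵀ *
          (PKaux g K j + PKaux g K j * g.D (N - (j+1)) *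
            (g.Rw (N - (j+1)) - (g.D (N - (j+1)))ᵀ * PKaux g K j * g.D (N - (j+1)))⁻¹ *
            (g.D (N - (j+1)))ᵀ * PKaux g K j) *
          (g.A (N - (j+1)) - g.B (N - (j+1)) * K (N - (j+1)))

/-- Inner-loop Riccati matrix `P^K_t`. -/
def PK (g : LQGame m d n N) (K : ℕ → Matrix (Fin d) (Fin m) ℝ) (t : ℕ) :
    Matrix (Fin m) (Fin m) ℝ :=
  PKaux g K (N - t)

/-- `P̃^K_{t+1}`. -/
def Ptilde (g : LQGame m d n N) (K : ℕ → Matrix (Fin d) (Fin m) ℝ) (t : ℕ) :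
    Matrix (Fin m) (Fin m) ℝ :=
  g.PK K (t+1) + g.PK K (t+1) * g.D t *
    (g.Rw t - (g.D t)ᵀ * g.PK K (t+1) * g.D t)⁻¹ * (g.D t)ᵀ * g.PK K (t+1)

/-- `K ∈ 𝒦`. -/
def Admissible (g : LQGame m d n N) (K : ℕ → Matrix (Fin d) (Fin m) ℝ) : Prop :=
  ∀ t < N, (g.Rw t - (g.D t)ᵀ * g.PK K (t+1) * g.D t).PosDef

/-- The inner maximizer `L(K)`. -/
def Lopt (g : LQGame m d n N) (K : ℕ → Matrix (Fin d) (Fin m) ℝ) (t : ℕ) :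
    Matrix (Fin n) (Fin m) ℝ :=
  (-(g.Rw t) + (g.D t)ᵀ * g.PK K (t+1) * g.D t)⁻¹ *
    ((g.D t)ᵀ * g.PK K (t+1) * (g.A t - g.B t * K t))

/-- State covariances `X^{K,L}_t`. -/
def Xcov (g : LQGame m d n N) (K : ℕ → Matrix (Fin d) (Fin m) ℝ)
    (L : ℕ → Matrix (Fin n) (Fin m) ℝ) : ℕ → Matrix (Fin m) (Fin m) ℝ
  | 0 => g.Sig 0
  | t + 1 =>
      (g.A t - g.B t * K t - g.D t * L t) * Xcov g K L t *
        (g.A t - g.B t * K t - g.D t * L t)ᵀ + g.Sig (t+1)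

/-- The game value `G(K,L)`. -/
def value (g : LQGame m d n N) (K : ℕ → Matrix (Fin d) (Fin m) ℝ)
    (L : ℕ → Matrix (Fin n) (Fin m) ℝ) : ℝ :=
  ∑ t ∈ Finset.range (N+1), ((g.PKL K L t) * g.Sig t).trace

/-- `E^{K,L}_t`. -/
def Emat (g : LQGame m d n N) (K : ℕ → Matrix (Fin d) (Fin m) ℝ)
    (L : ℕ → Matrix (Fin n) (Fin m) ℝ) (t : ℕ) : Matrix (Fin n) (Fin m) ℝ :=
  (-(g.Rw t) + (g.D t)ᵀ * g.PKL K L (t+1) * g.D t) * L t -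
    (g.D t)ᵀ * g.PKL K L (t+1) * (g.A t - g.B t * K t)

/-- `H^{K,L}_t`. -/
def Hmat (g : LQGame m d n N) (K : ℕ → Matrix (Fin d) (Fin m) ℝ)
    (L : ℕ → Matrix (Fin n) (Fin m) ℝ) (t : ℕ) : Matrix (Fin n) (Fin n) ℝ :=
  g.Rw t - (g.D t)ᵀ * g.PKL K L (t+1) * g.D t

/-- `F^K_t`. -/
def Fmat (g : LQGame m d n N) (K : ℕ → Matrix (Fin d) (Fin m) ℝ) (t : ℕ) :
    Matrix (Fin d) (Fin m) ℝ :=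
  (g.Ru t + (g.B t)ᵀ * g.Ptilde K t * g.B t) * K t - (g.B t)ᵀ * g.Ptilde K t * g.A t

/-- `G^K_t`. -/
def Gmat (g : LQGame m d n N) (K : ℕ → Matrix (Fin d) (Fin m) ℝ) (t : ℕ) :
    Matrix (Fin d) (Fin d) ℝ :=
  g.Ru t + (g.B t)ᵀ * g.Ptilde K t * g.B t

/-- Game Riccati recursion `P*` indexed by steps before terminal time. -/
def Pstaraux (g : LQGame m d n N) : ℕ → Matrix (Fin m) (Fin m) ℝ
  | 0 => g.QN
  | j + 1 =>
      g.Q (N - (j+1)) + (g.A (N - (j+1)))ᵀ * Pstaraux g j *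
        (1 + (g.B (N - (j+1)) * (g.Ru (N - (j+1)))⁻¹ * (g.B (N - (j+1)))ᵀ
            - g.D (N - (j+1)) * (g.Rw (N - (j+1)))⁻¹ * (g.D (N - (j+1)))ᵀ) * Pstaraux g j)⁻¹ *
        g.A (N - (j+1))

/-- `P*_t`. -/
def Pstar (g : LQGame m d n N) (t : ℕ) : Matrix (Fin m) (Fin m) ℝ :=
  Pstaraux g (N - t)

/-- `Λ_t` of the game Riccati recursion. -/
def LambdaStar (g : LQGame m d n N) (t : ℕ) : Matrix (Fin m) (Fin m) ℝ :=
  1 + (g.B t * (g.Ru t)⁻¹ * (g.B t)ᵀ - g.D t * (g.Rw t)⁻¹ * (g.D t)ᵀ) * g.Pstar (t+1)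

/-- Assumption 2.4. -/
def Assumption24 (g : LQGame m d n N) : Prop :=
  (∀ t < N, IsUnit (g.LambdaStar t)) ∧ (∀ t ≤ N, (g.Pstar t).PosSemidef) ∧
    (∀ t < N, (g.Rw t - (g.D t)ᵀ * g.Pstar (t+1) * g.D t).PosDef)

/-- `φ := min_{0 ≤ t ≤ N} λ_min(Σ⁰_t)`. -/
def phi (g : LQGame m d n N) : ℝ :=
  (Finset.range (N+1)).inf' (Finset.nonempty_range_iff.mpr (Nat.succ_ne_zero N))
    (fun t => eigMin (g.Sig t))

end LQGame

open scoped MatrixOrder in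
/-- Every real positive semidefinite matrix is a Gram matrix. -/
theorem Matrix.PosSemidef.exists_eq_transpose_mul_self {a : ℕ} {X : Matrix (Fin a) (Fin a) ℝ}
    (hX : X.PosSemidef) : ∃ C : Matrix (Fin a) (Fin a) ℝ, X = Cᵀ * C := by
  obtain ⟨C, hC⟩ := CStarAlgebra.nonneg_iff_eq_star_mul_self.mp hX.nonneg
  exact ⟨C, by rw [hC, star_eq_conjTranspose, conjTranspose_eq_transpose_of_trivial]⟩

theorem Matrix.PosDef.eq_zero_of_transpose_mul_mul_eq_zero {a b : ℕ}
    {S : Matrix (Fin a) (Fin a) ℝ} (hS : S.PosDef) {Z : Matrix (Fin a) (Fin b) ℝ}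
    (h : Zᵀ * S * Z = 0) : Z = 0 := by
  obtain ⟨C, hC⟩ := hS.posSemidef.exists_eq_transpose_mul_self
  have hCZ : C * Z = 0 := by
    rw [← conjTranspose_mul_self_eq_zero, conjTranspose_eq_transpose_of_trivial, transpose_mul,
      Matrix.mul_assoc, ← Matrix.mul_assoc Cᵀ, ← hC, ← Matrix.mul_assoc, h]
  have hSZ : S * Z = 0 := by rw [hC, Matrix.mul_assoc, hCZ, Matrix.mul_zero]
  rw [← Matrix.one_mul Z, ← nonsing_inv_mul S (S.isUnit_iff_isUnit_det.mp hS.isUnit),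
    Matrix.mul_assoc, hSZ, Matrix.mul_zero]

theorem Matrix.PosSemidef.transpose_mul_mul_same {a b : ℕ} {S : Matrix (Fin a) (Fin a) ℝ}
    (hS : S.PosSemidef) (Z : Matrix (Fin a) (Fin b) ℝ) : (Zᵀ * S * Z).PosSemidef := by
  simpa only [conjTranspose_eq_transpose_of_trivial] using hS.conjTranspose_mul_mul_same Z

theorem Matrix.PosSemidef.trace_mul_nonneg {a : ℕ} {X S : Matrix (Fin a) (Fin a) ℝ}
    (hX : X.PosSemidef) (hS : S.PosSemidef) : 0 ≤ (X * S).trace := by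
  obtain ⟨C, rfl⟩ := hX.exists_eq_transpose_mul_self
  rw [Matrix.mul_assoc, trace_mul_comm]
  simpa using (hS.transpose_mul_mul_same Cᵀ).trace_nonneg

theorem Matrix.PosSemidef.eq_zero_of_trace_mul_eq_zero {a : ℕ}
    {X S : Matrix (Fin a) (Fin a) ℝ} (hX : X.PosSemidef) (hS : S.PosDef)
    (h : (X * S).trace = 0) : X = 0 := by
  obtain ⟨C, rfl⟩ := hX.exists_eq_transpose_mul_self
  rw [Matrix.mul_assoc, trace_mul_comm] at h
  have hC : Cᵀ = 0 := hS.eq_zero_of_transpose_mul_mul_eq_zero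
    ((hS.posSemidef.transpose_mul_mul_same Cᵀ).trace_eq_zero_iff.mp (by simpa using h))
  rw [hC, Matrix.zero_mul]

namespace LQGame

variable {m d n N : ℕ}

/-- Completion of squares for one step of the inner-loop recursion: the gap between the Riccati
update of `P` and the update of `P'` under the gain `L`. -/
theorem riccati_sub_step {M P P' Q : Matrix (Fin m) (Fin m) ℝ} {D : Matrix (Fin m) (Fin n) ℝ}
    {R : Matrix (Fin n) (Fin n) ℝ} {V : Matrix (Fin m) (Fin m) ℝ}
    (hP : Pᵀ = P) (hS : (R - Dᵀ * P * D).PosDef) (L : Matrix (Fin n) (Fin m) ℝ) :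
    (Q + V + Mᵀ * (P + P * D * (R - Dᵀ * P * D)⁻¹ * Dᵀ * P) * M)
        - ((M - D * L)ᵀ * P' * (M - D * L) + Q + V - Lᵀ * R * L)
      = (M - D * L)ᵀ * (P - P') * (M - D * L)
        + (L - (-R + Dᵀ * P * D)⁻¹ * (Dᵀ * P * M))ᵀ * (R - Dᵀ * P * D)
          * (L - (-R + Dᵀ * P * D)⁻¹ * (Dᵀ * P * M)) := by
  set S := R - Dᵀ * P * D with hSdef
  have hdet : IsUnit S.det := S.isUnit_iff_isUnit_det.mp hS.isUnit
  have hSt : Sᵀ = S := by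
    simpa only [conjTranspose_eq_transpose_of_trivial] using hS.isHermitian.eq
  have hneg : (-R + Dᵀ * P * D)⁻¹ = -S⁻¹ := by
    apply inv_eq_left_inv
    rw [show -R + Dᵀ * P * D = -S by rw [hSdef]; abel, neg_mul_neg,
      nonsing_inv_mul S hdet]
  have hR : R = S + Dᵀ * P * D := by rw [hSdef]; abel
  set Y := S⁻¹ * (Dᵀ * P * M) with hY
  have hSY : S * Y = Dᵀ * P * M := by
    rw [hY, ← Matrix.mul_assoc, mul_nonsing_inv S hdet, Matrix.one_mul]
  have hYS : Yᵀ * S = Mᵀ * P * D := by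
    have := congrArg transpose hSY
    simpa only [transpose_mul, transpose_transpose, hSt, hP, Matrix.mul_assoc] using this
  have hmid : Mᵀ * (P + P * D * S⁻¹ * Dᵀ * P) * M = Mᵀ * P * M + Yᵀ * S * Y := by
    rw [hYS, hY]
    simp only [Matrix.mul_add, Matrix.add_mul, Matrix.mul_assoc]
  have hsq : (L + Y)ᵀ * S * (L + Y)
      = Lᵀ * S * L + Lᵀ * (Dᵀ * P * M) + Mᵀ * P * D * L + Yᵀ * S * Y := by
    rw [← hSY, ← hYS, transpose_add]
    simp only [Matrix.mul_add, Matrix.add_mul, Matrix.mul_assoc]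
    abel
  rw [hneg, Matrix.neg_mul, ← hY, sub_neg_eq_add, hsq, hmid, hR]
  simp only [transpose_sub, transpose_mul, Matrix.mul_add, Matrix.add_mul, Matrix.mul_sub,
    Matrix.sub_mul, Matrix.mul_assoc]
  abel

theorem PK_terminal (g : LQGame m d n N) (K : ℕ → Matrix (Fin d) (Fin m) ℝ) :
    g.PK K N = g.QN := by
  simp [PK, PKaux]

theorem PKL_terminal (g : LQGame m d n N) (K : ℕ → Matrix (Fin d) (Fin m) ℝ)
    (L : ℕ → Matrix (Fin n) (Fin m) ℝ) : g.PKL K L N = g.QN := by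
  simp [PKL, PKLaux]

theorem PK_eq (g : LQGame m d n N) (K : ℕ → Matrix (Fin d) (Fin m) ℝ) {t : ℕ} (ht : t < N) :
    g.PK K t = g.Q t + (K t)ᵀ * g.Ru t * K t
      + (g.A t - g.B t * K t)ᵀ * g.Ptilde K t * (g.A t - g.B t * K t) := by
  have h : N - t = (N - (t + 1)) + 1 := by omega
  have h' : N - (N - (t + 1) + 1) = t := by omega
  rw [PK, h, PKaux, h']
  rfl

theorem PKL_eq (g : LQGame m d n N) (K : ℕ → Matrix (Fin d) (Fin m) ℝ)
    (L : ℕ → Matrix (Fin n) (Fin m) ℝ) {t : ℕ} (ht : t < N) :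
    g.PKL K L t = (g.A t - g.B t * K t - g.D t * L t)ᵀ * g.PKL K L (t + 1)
        * (g.A t - g.B t * K t - g.D t * L t)
      + g.Q t + (K t)ᵀ * g.Ru t * K t - (L t)ᵀ * g.Rw t * L t := by
  have h : N - t = (N - (t + 1)) + 1 := by omega
  have h' : N - (N - (t + 1) + 1) = t := by omega
  rw [PKL, h, PKLaux, h']
  rfl

theorem PK_transpose (g : LQGame m d n N) {K : ℕ → Matrix (Fin d) (Fin m) ℝ}
    (hK : g.Admissible K) {t : ℕ} (ht : t ≤ N) : (g.PK K t)ᵀ = g.PK K t := by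
  induction ht using Nat.decreasingInduction with
  | self => simpa [PK_terminal] using g.hQN.isHermitian.eq
  | of_succ t ht ih =>
    have hQ : (g.Q t)ᵀ = g.Q t := by simpa using (g.hQ t ht).isHermitian.eq
    have hRu : (g.Ru t)ᵀ = g.Ru t := by simpa using (g.hRu t ht).isHermitian.eq
    have hS := (hK t ht).isHermitian.eq
    rw [conjTranspose_eq_transpose_of_trivial, Matrix.mul_assoc] at hS
    rw [PK_eq g K ht, Ptilde]
    simp only [transpose_add, transpose_mul, transpose_transpose, transpose_nonsing_inv, hS, hQ,
      hRu, ih, Matrix.mul_assoc]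

theorem PK_sub_PKL (g : LQGame m d n N) {K : ℕ → Matrix (Fin d) (Fin m) ℝ}
    (hK : g.Admissible K) (L : ℕ → Matrix (Fin n) (Fin m) ℝ) {t : ℕ} (ht : t < N) :
    g.PK K t - g.PKL K L t
      = (g.A t - g.B t * K t - g.D t * L t)ᵀ * (g.PK K (t + 1) - g.PKL K L (t + 1))
          * (g.A t - g.B t * K t - g.D t * L t)
        + (L t - g.Lopt K t)ᵀ * (g.Rw t - (g.D t)ᵀ * g.PK K (t + 1) * g.D t)
          * (L t - g.Lopt K t) := by
  rw [PK_eq g K ht, PKL_eq g K L ht]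
  exact riccati_sub_step (g.PK_transpose hK ht) (hK t ht) (L t)

theorem PK_sub_PKL_posSemidef (g : LQGame m d n N) {K : ℕ → Matrix (Fin d) (Fin m) ℝ}
    (hK : g.Admissible K) (L : ℕ → Matrix (Fin n) (Fin m) ℝ) {t : ℕ} (ht : t ≤ N) :
    (g.PK K t - g.PKL K L t).PosSemidef := by
  induction ht using Nat.decreasingInduction with
  | self => simpa [PK_terminal, PKL_terminal] using PosSemidef.zero
  | of_succ t ht ih =>
    rw [PK_sub_PKL g hK L ht]
    exact (ih.transpose_mul_mul_same _).add ((hK t ht).posSemidef.transpose_mul_mul_same _)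

theorem PKL_Lopt (g : LQGame m d n N) {K : ℕ → Matrix (Fin d) (Fin m) ℝ}
    (hK : g.Admissible K) {t : ℕ} (ht : t ≤ N) : g.PKL K (g.Lopt K) t = g.PK K t := by
  induction ht using Nat.decreasingInduction with
  | self => rw [PK_terminal, PKL_terminal]
  | of_succ t ht ih =>
    refine (sub_eq_zero.mp ?_).symm
    rw [PK_sub_PKL g hK _ ht, ih]
    simp

theorem value_Lopt_sub_value (g : LQGame m d n N) {K : ℕ → Matrix (Fin d) (Fin m) ℝ}
    (hK : g.Admissible K) (L : ℕ → Matrix (Fin n) (Fin m) ℝ) :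
    g.value K (g.Lopt K) - g.value K L
      = ∑ t ∈ Finset.range (N + 1), ((g.PK K t - g.PKL K L t) * g.Sig t).trace := by
  rw [value, value, ← Finset.sum_sub_distrib]
  refine Finset.sum_congr rfl fun t ht => ?_
  rw [PKL_Lopt g hK (Finset.mem_range_succ_iff.mp ht), Matrix.sub_mul, trace_sub]

theorem trace_PK_sub_PKL_mul_Sig_nonneg (g : LQGame m d n N)
    {K : ℕ → Matrix (Fin d) (Fin m) ℝ} (hK : g.Admissible K)
    (L : ℕ → Matrix (Fin n) (Fin m) ℝ) {t : ℕ} (ht : t ∈ Finset.range (N + 1)) :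
    0 ≤ ((g.PK K t - g.PKL K L t) * g.Sig t).trace :=
  have ht' := Finset.mem_range_succ_iff.mp ht
  (g.PK_sub_PKL_posSemidef hK L ht').trace_mul_nonneg (g.hSig t ht').posSemidef

theorem value_le_value_Lopt (g : LQGame m d n N) {K : ℕ → Matrix (Fin d) (Fin m) ℝ}
    (hK : g.Admissible K) (L : ℕ → Matrix (Fin n) (Fin m) ℝ) :
    g.value K L ≤ g.value K (g.Lopt K) := by
  rw [← sub_nonneg, value_Lopt_sub_value g hK L]
  exact Finset.sum_nonneg fun t ht => g.trace_PK_sub_PKL_mul_Sig_nonneg hK L ht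

theorem eq_Lopt_of_value_eq (g : LQGame m d n N) {K : ℕ → Matrix (Fin d) (Fin m) ℝ}
    (hK : g.Admissible K) {L : ℕ → Matrix (Fin n) (Fin m) ℝ}
    (hL : g.value K L = g.value K (g.Lopt K)) {t : ℕ} (ht : t < N) : L t = g.Lopt K t := by
  have hsum := value_Lopt_sub_value g hK L
  rw [hL, sub_self, eq_comm,
    Finset.sum_eq_zero_iff_of_nonneg fun t ht => g.trace_PK_sub_PKL_mul_Sig_nonneg hK L ht]
    at hsum
  have hzero : ∀ s ≤ N, g.PK K s - g.PKL K L s = 0 := fun s hs =>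
    (g.PK_sub_PKL_posSemidef hK L hs).eq_zero_of_trace_mul_eq_zero (g.hSig s hs)
      (hsum s (Finset.mem_range_succ_iff.mpr hs))
  have hgap := PK_sub_PKL g hK L ht
  rw [hzero t ht.le, hzero (t + 1) ht, Matrix.mul_zero, Matrix.zero_mul, zero_add] at hgap
  exact sub_eq_zero.mp ((hK t ht).eq_zero_of_transpose_mul_mul_eq_zero hgap.symm)

end LQGame

/-- for admissible `K`, the Riccati matrices `P^K_t` dominate every `P^{K,L}_t`,
the bound is attained by the inner maximizer `L(K)`, so `G(K,·)` is maximized at `L(K)`,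
uniquely so (on the relevant time range). -/
theorem LQGame.inner_maximizer_optimal {m d n N : ℕ} (g : LQGame m d n N) (hN : 0 < N)
    (K : ℕ → Matrix (Fin d) (Fin m) ℝ) (hK : g.Admissible K) :
    (∀ (L : ℕ → Matrix (Fin n) (Fin m) ℝ) (t : ℕ), t ≤ N →
        (g.PK K t - g.PKL K L t).PosSemidef)
    ∧ (∀ t : ℕ, t ≤ N → g.PKL K (g.Lopt K) t = g.PK K t)
    ∧ (∀ L : ℕ → Matrix (Fin n) (Fin m) ℝ, g.value K L ≤ g.value K (g.Lopt K))
    ∧ (∀ L : ℕ → Matrix (Fin n) (Fin m) ℝ,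
        (∀ L' : ℕ → Matrix (Fin n) (Fin m) ℝ, g.value K L' ≤ g.value K L) →
        ∀ t : ℕ, t < N → L t = g.Lopt K t) := by
  exact ⟨fun L _ ht => g.PK_sub_PKL_posSemidef hK L ht, fun _ ht => g.PKL_Lopt hK ht,
    g.value_le_value_Lopt hK, fun L hL _ ht =>
      g.eq_Lopt_of_value_eq hK (le_antisymm (g.value_le_value_Lopt hK L) (hL _)) ht⟩
end
end

section
/- Fix a minimizer gain K and suppose there is τ ∈ {0,…,N−1} such that R^w_s − D_sᵀP^K_{s+1}D_s is positive definite for every s ∈ {τ+1,…,N−1} (so the Riccati matrices P^K_s are well defined down to s = τ+1), while the symmetric matrix R^w_τ − D_τᵀP^K_{τ+1}D_τ has a strictly negative eigenvalue. Then the inner maximization problem is ill posed: for every M ∈ ℝ there exists a maximizer gain L with G(K,L) > M, i.e. sup_L G(K,L) = +∞. -/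
open Matrix

noncomputable section

namespace LQGame

/-- A real quadratic polynomial with positive leading coefficient is unbounded above. -/
lemma exists_lt_quadratic (u v w M : ℝ) (hw : 0 < w) :
    ∃ c : ℝ, M < u + c * v + c ^ 2 * w := by
  set c : ℝ := (|v| + 1 + |M - u|) / w + 1 with hc
  have hdiv : 0 ≤ (|v| + 1 + |M - u|) / w := by positivity
  have hcw : c * w = |v| + 1 + |M - u| + w := by
    rw [hc]
    field_simp
  have hc_one : 1 ≤ c := by linarith
  have hslope : 1 + |M - u| ≤ v + c * w := by linarith [neg_abs_le v]
  refine ⟨c, ?_⟩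
  nlinarith [le_abs_self (M - u), abs_nonneg (M - u),
    mul_nonneg (sub_nonneg.2 hc_one) (sub_nonneg.2 hslope)]

/-- Completion of squares for one step of the inner Riccati recursion, without symmetry of `P`. -/
lemma riccati_step {m n : ℕ} (F P : Matrix (Fin m) (Fin m) ℝ) (D : Matrix (Fin m) (Fin n) ℝ)
    (R : Matrix (Fin n) (Fin n) ℝ) (L : Matrix (Fin n) (Fin m) ℝ)
    (hH : IsUnit (R - Dᵀ * P * D)) (hL : L = (-R + Dᵀ * P * D)⁻¹ * (Dᵀ * P * F)) :
    (F - D * L)ᵀ * P * (F - D * L) - Lᵀ * R * L =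
      Fᵀ * (P + P * D * (R - Dᵀ * P * D)⁻¹ * Dᵀ * P) * F := by
  have hdet := (Matrix.isUnit_iff_isUnit_det _).1 hH
  have hneg : (-R + Dᵀ * P * D)⁻¹ = -(R - Dᵀ * P * D)⁻¹ := by
    apply Matrix.inv_eq_right_inv
    rw [show -R + Dᵀ * P * D = -(R - Dᵀ * P * D) by abel, neg_mul_neg,
      Matrix.mul_nonsing_inv _ hdet]
  rw [hneg] at hL
  have hHL : (R - Dᵀ * P * D) * L = -(Dᵀ * P * F) := by
    rw [hL, Matrix.neg_mul, Matrix.mul_neg, Matrix.mul_nonsing_inv_cancel_left _ _ hdet]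
  have hexpand : (F - D * L)ᵀ * P * (F - D * L) - Lᵀ * R * L =
      Fᵀ * P * F - Fᵀ * P * D * L - Lᵀ * (Dᵀ * P * F) - Lᵀ * ((R - Dᵀ * P * D) * L) := by
    simp only [Matrix.transpose_sub, Matrix.transpose_mul, Matrix.sub_mul, Matrix.mul_sub,
      Matrix.mul_assoc]
    abel
  rw [hexpand, hHL, hL]
  simp only [Matrix.mul_neg, Matrix.neg_mul, Matrix.mul_add, Matrix.add_mul, Matrix.mul_assoc]
  abel

variable {m d n N : ℕ}

/-- The maximizer gain that vanishes before `τ`, equals `E` at `τ`, and is the inner maximizer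
after `τ`. -/
def spikeGain (g : LQGame m d n N) (K : ℕ → Matrix (Fin d) (Fin m) ℝ) (τ : ℕ)
    (E : Matrix (Fin n) (Fin m) ℝ) : ℕ → Matrix (Fin n) (Fin m) ℝ :=
  fun s => if s < τ then 0 else if s = τ then E else g.Lopt K s

/-- After `τ`, the value matrices of a spike gain are the inner Riccati matrices. -/
lemma PKLaux_spikeGain_of_lt (g : LQGame m d n N) (K : ℕ → Matrix (Fin d) (Fin m) ℝ) (τ : ℕ)
    (hPD : ∀ s : ℕ, τ < s → s < N → (g.Rw s - (g.D s)ᵀ * g.PK K (s+1) * g.D s).PosDef)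
    (E : Matrix (Fin n) (Fin m) ℝ) (j : ℕ) (hj : j + τ < N) :
    g.PKLaux K (g.spikeGain K τ E) j = g.PKaux K j := by
  induction j with
  | zero => rfl
  | succ j ih =>
    have hPK : g.PK K (N - (j+1) + 1) = g.PKaux K j := by
      rw [PK]
      congr 1
      omega
    have hH := (hPD (N - (j+1)) (by omega) (by omega)).isUnit
    have hL : g.spikeGain K τ E (N - (j+1)) = g.Lopt K (N - (j+1)) := by
      rw [spikeGain, if_neg (by omega), if_neg (by omega)]
    rw [PKLaux, PKaux, ih (by omega), hL]
    rw [Lopt, hPK]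
    rw [hPK] at hH
    rw [← riccati_step _ _ _ _ _ hH rfl]
    abel

/-- From `τ` backward, the value matrices of the spike gains `c • x yᵀ` are quadratic in `c`, with
rank-one leading coefficient. -/
lemma PKLaux_spikeGain_quadratic (g : LQGame m d n N) (K : ℕ → Matrix (Fin d) (Fin m) ℝ)
    (τ : ℕ) (hτ : τ < N)
    (hPD : ∀ s : ℕ, τ < s → s < N → (g.Rw s - (g.D s)ᵀ * g.PK K (s+1) * g.D s).PosDef)
    (x : Fin n → ℝ) (y : Fin m → ℝ) (i : ℕ) (hi : i ≤ τ) :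
    ∃ (U V : Matrix (Fin m) (Fin m) ℝ) (z : Fin m → ℝ), (i = 0 → z = y) ∧ ∀ c : ℝ,
      g.PKLaux K (g.spikeGain K τ (c • vecMulVec x y)) (N - τ + i) =
        U + c • V + c ^ 2 •
          ((-(x ⬝ᵥ (g.Rw τ - (g.D τ)ᵀ * g.PK K (τ+1) * g.D τ).mulVec x)) • vecMulVec z z) := by
  induction i with
  | zero =>
    set P := g.PK K (τ+1) with hP
    set F := g.A τ - g.B τ * K τ with hF
    set E := vecMulVec x y with hE
    refine ⟨Fᵀ * P * F + g.Q τ + (K τ)ᵀ * g.Ru τ * K τ,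
      -(Fᵀ * P * (g.D τ * E)) - (g.D τ * E)ᵀ * P * F, y, fun _ => rfl, fun c => ?_⟩
    have hlead : (-(x ⬝ᵥ (g.Rw τ - (g.D τ)ᵀ * P * g.D τ).mulVec x)) • vecMulVec y y =
        -(Eᵀ * (g.Rw τ - (g.D τ)ᵀ * P * g.D τ) * E) := by
      rw [hE, Matrix.transpose_vecMulVec, Matrix.vecMulVec_mul, Matrix.vecMulVec_mul_vecMulVec,
        ← Matrix.dotProduct_mulVec, neg_smul, Matrix.vecMulVec_smul]
    have hj : N - τ + 0 = (N - (τ+1)) + 1 := by omega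
    have ht : N - (N - (τ+1) + 1) = τ := by omega
    have hL : g.spikeGain K τ (c • E) τ = c • E := by simp [spikeGain]
    rw [hlead, hj, PKLaux, ht, hL, g.PKLaux_spikeGain_of_lt K τ hPD _ _ (by omega), ← hF,
      show g.PKaux K (N - (τ+1)) = P from rfl]
    simp only [Matrix.transpose_sub, Matrix.transpose_mul, Matrix.transpose_smul, Matrix.sub_mul,
      Matrix.mul_sub, Matrix.mul_smul, Matrix.smul_mul, Matrix.mul_assoc]
    module
  | succ i ih =>
    obtain ⟨U, V, z, -, h⟩ := ih (by omega)
    set t := N - (N - τ + i + 1) with ht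
    set F := g.A t - g.B t * K t with hF
    refine ⟨Fᵀ * U * F + g.Q t + (K t)ᵀ * g.Ru t * K t, Fᵀ * V * F, Fᵀ *ᵥ z, by omega,
      fun c => ?_⟩
    have hL : g.spikeGain K τ (c • vecMulVec x y) t = 0 := by
      rw [spikeGain, if_pos (by omega)]
    have hz : vecMulVec (Fᵀ *ᵥ z) (Fᵀ *ᵥ z) = Fᵀ * vecMulVec z z * F := by
      rw [Matrix.mul_vecMulVec, Matrix.vecMulVec_mul, Matrix.mulVec_transpose]
    rw [← add_assoc, PKLaux, h c, ← ht, hL, hz, ← hF]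
    simp only [Matrix.mul_zero, sub_zero, Matrix.mul_add, Matrix.add_mul, Matrix.mul_smul,
      Matrix.smul_mul]
    abel

/-- Along the spike gains `c • x yᵀ`, each summand of the game value is quadratic in `c`. -/
lemma trace_PKL_spikeGain_quadratic (g : LQGame m d n N) (K : ℕ → Matrix (Fin d) (Fin m) ℝ)
    (τ : ℕ) (hτ : τ < N)
    (hPD : ∀ s : ℕ, τ < s → s < N → (g.Rw s - (g.D s)ᵀ * g.PK K (s+1) * g.D s).PosDef)
    (x : Fin n → ℝ) (hx : x ⬝ᵥ (g.Rw τ - (g.D τ)ᵀ * g.PK K (τ+1) * g.D τ).mulVec x < 0)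
    (y : Fin m → ℝ) (hy : y ≠ 0) (t : ℕ) :
    ∃ u v w : ℝ, t ≤ N → 0 ≤ w ∧ (t = τ → 0 < w) ∧ ∀ c : ℝ,
      (g.PKL K (g.spikeGain K τ (c • vecMulVec x y)) t * g.Sig t).trace =
        u + c * v + c ^ 2 * w := by
  by_cases htN : t ≤ N
  swap
  · exact ⟨0, 0, 0, fun h => absurd h htN⟩
  rcases lt_or_ge τ t with hlt | hle
  · refine ⟨(g.PK K t * g.Sig t).trace, 0, 0, fun _ => ⟨le_rfl, fun h => by omega, fun c => ?_⟩⟩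
    rw [PKL, g.PKLaux_spikeGain_of_lt K τ hPD _ _ (by omega), PK]
    ring
  · obtain ⟨U, V, z, hz, h⟩ :=
      g.PKLaux_spikeGain_quadratic K τ hτ hPD x y (τ - t) (by omega)
    set a := -(x ⬝ᵥ (g.Rw τ - (g.D τ)ᵀ * g.PK K (τ+1) * g.D τ).mulVec x) with ha
    have ha_pos : 0 < a := by linarith
    have hSig := g.hSig t htN
    refine ⟨(U * g.Sig t).trace, (V * g.Sig t).trace, a * (z ⬝ᵥ (g.Sig t).mulVec z),
      fun _ => ⟨?_, ?_, fun c => ?_⟩⟩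
    · exact mul_nonneg ha_pos.le (by simpa using hSig.posSemidef.dotProduct_mulVec_nonneg z)
    · intro ht
      rw [hz (by omega)]
      exact mul_pos ha_pos (by simpa using hSig.dotProduct_mulVec_pos hy)
    · rw [PKL, show N - t = N - τ + (τ - t) by omega, h c]
      simp only [Matrix.add_mul, Matrix.smul_mul, Matrix.trace_add, Matrix.trace_smul,
        smul_eq_mul, Matrix.vecMulVec_mul, Matrix.trace_vecMulVec]
      rw [dotProduct_comm z (z ᵥ* g.Sig t), ← Matrix.dotProduct_mulVec]

end LQGame

/-- if the Riccati recursion is well defined down to time `τ+1` but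
`R^w_τ − D_τᵀ P^K_{τ+1} D_τ` has a strictly negative eigenvalue, then the
inner maximization is ill posed: `sup_L G(K,L) = +∞`. -/
theorem LQGame.inner_ill_posed {m d n N : ℕ} (g : LQGame m d n N)
    (K : ℕ → Matrix (Fin d) (Fin m) ℝ) (τ : ℕ) (hτ : τ < N)
    (hPD : ∀ s : ℕ, τ < s → s < N → (g.Rw s - (g.D s)ᵀ * g.PK K (s+1) * g.D s).PosDef)
    (hneg : ∃ x : Fin n → ℝ,
      x ⬝ᵥ (g.Rw τ - (g.D τ)ᵀ * g.PK K (τ+1) * g.D τ).mulVec x < 0) :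
    ∀ M : ℝ, ∃ L : ℕ → Matrix (Fin n) (Fin m) ℝ, M < g.value K L := by
  intro M
  obtain ⟨x, hx⟩ := hneg
  have hm : 0 < m := by
    rcases Nat.eq_zero_or_pos m with rfl | hm
    · have hzero : (g.D τ)ᵀ * g.PK K (τ+1) * g.D τ = 0 := by
        ext i j
        simp [Matrix.mul_apply]
      rw [hzero, sub_zero] at hx
      have hnonneg := (g.hRw τ hτ).posSemidef.dotProduct_mulVec_nonneg x
      simp only [star_trivial] at hnonneg
      exact absurd hx (not_lt.2 hnonneg)
    · exact hm
  have hy : (fun _ : Fin m => (1 : ℝ)) ≠ 0 := fun h => one_ne_zero (congrFun h ⟨0, hm⟩)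
  choose u v w h using g.trace_PKL_spikeGain_quadratic K τ hτ hPD x hx _ hy
  have hle : ∀ t ∈ Finset.range (N+1), t ≤ N := fun t ht =>
    Nat.lt_succ_iff.1 (Finset.mem_range.1 ht)
  have hw : 0 < ∑ t ∈ Finset.range (N+1), w t :=
    Finset.sum_pos' (fun t ht => (h t (hle t ht)).1)
      ⟨τ, Finset.mem_range.2 (by omega), (h τ hτ.le).2.1 rfl⟩
  obtain ⟨c, hc⟩ := exists_lt_quadratic (∑ t ∈ Finset.range (N+1), u t)
    (∑ t ∈ Finset.range (N+1), v t) _ M hw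
  refine ⟨g.spikeGain K τ (c • vecMulVec x fun _ => 1), hc.trans_eq ?_⟩
  rw [value, Finset.sum_congr rfl fun t ht => (h t (hle t ht)).2.2 c, Finset.sum_add_distrib,
    Finset.sum_add_distrib, Finset.mul_sum, Finset.mul_sum]
end
end

section
/- (Outer-loop cost difference identity.) Fix t ∈ {0,…,N−1} and symmetric positive semidefinite m×m matrices P_{t+1}, P'_{t+1} with both R^w_t − D_tᵀP_{t+1}D_t and R^w_t − D_tᵀP'_{t+1}D_t positive definite. Given gains K_t, K'_t ∈ ℝ^{d×m}, define P̃_{t+1} := P_{t+1} + P_{t+1}D_t(R^w_t − D_tᵀP_{t+1}D_t)⁻¹D_tᵀP_{t+1} and P̃'_{t+1} analogously from P'_{t+1}; P_t := Q_t + K_tᵀR^u_tK_t + (A_t − B_tK_t)ᵀP̃_{t+1}(A_t − B_tK_t) and P'_t := Q_t + (K'_t)ᵀR^u_tK'_t + (A_t − B_tK'_t)ᵀP̃'_{t+1}(A_t − B_tK'_t); L'_t := (−R^w_t + D_tᵀP'_{t+1}D_t)⁻¹D_tᵀP'_{t+1}(A_t − B_tK'_t); F_t := (R^u_t + B_tᵀP̃_{t+1}B_t)K_t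 − B_tᵀP̃_{t+1}A_t; A^{cl}_t := A_t − B_tK'_t − D_tL'_t; Ξ_t := −(R^w_t − D_tᵀP_{t+1}D_t)L'_t − D_tᵀP_{t+1}(A_t − B_tK'_t); and ℛ_t := (K'_t − K_t)ᵀF_t + F_tᵀ(K'_t − K_t) + (K'_t − K_t)ᵀ(R^u_t + B_tᵀP̃_{t+1}B_t)(K'_t − K_t). Then P'_t − P_t = (A^{cl}_t)ᵀ(P'_{t+1} − P_{t+1})A^{cl}_t + ℛ_t − Ξ_tᵀ(R^w_t − D_tᵀP_{t+1}D_t)⁻¹Ξ_t. -/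
open Matrix

noncomputable section

/-- Completion of squares in the disturbance gain `L`, with `H = R - Dᵀ P D`. -/
theorem LQGame.completion_of_squares {m n : ℕ} (P M : Matrix (Fin m) (Fin m) ℝ)
    (D : Matrix (Fin m) (Fin n) ℝ) (R : Matrix (Fin n) (Fin n) ℝ) (L : Matrix (Fin n) (Fin m) ℝ)
    (hP : Pᵀ = P) (hH : (R - Dᵀ * P * D).PosDef) :
    Mᵀ * (P + P * D * (R - Dᵀ * P * D)⁻¹ * Dᵀ * P) * M =
      (M - D * L)ᵀ * P * (M - D * L) - Lᵀ * R * L +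
        (-((R - Dᵀ * P * D) * L) - Dᵀ * P * M)ᵀ * (R - Dᵀ * P * D)⁻¹ *
          (-((R - Dᵀ * P * D) * L) - Dᵀ * P * M) := by
  obtain ⟨H, hHdef⟩ : ∃ H, H = R - Dᵀ * P * D := ⟨_, rfl⟩
  have hR : R = H + Dᵀ * P * D := by rw [hHdef]; abel
  rw [← hHdef] at hH ⊢
  have hHt : Hᵀ = H := by simpa using hH.isHermitian.eq
  have hdet : IsUnit H.det := (Matrix.isUnit_iff_isUnit_det H).mp hH.isUnit
  have hmul : ∀ X : Matrix (Fin n) (Fin m) ℝ, H * (H⁻¹ * X) = X := fun X =>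
    Matrix.mul_nonsing_inv_cancel_left H X hdet
  have hinv : ∀ X : Matrix (Fin n) (Fin m) ℝ, H⁻¹ * (H * X) = X := fun X =>
    Matrix.nonsing_inv_mul_cancel_left H X hdet
  rw [hR]
  simp only [Matrix.transpose_sub, Matrix.transpose_neg, Matrix.transpose_mul,
    Matrix.transpose_transpose, hP, hHt, Matrix.mul_add, Matrix.add_mul, Matrix.mul_sub,
    Matrix.sub_mul, Matrix.mul_neg, Matrix.neg_mul, Matrix.mul_assoc, hmul, hinv]
  abel

/-- Expansion of the control cost around the gain `K`. -/
theorem LQGame.control_cost_expansion {m d : ℕ} (A S : Matrix (Fin m) (Fin m) ℝ)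
    (B : Matrix (Fin m) (Fin d) ℝ) (R : Matrix (Fin d) (Fin d) ℝ)
    (K K' : Matrix (Fin d) (Fin m) ℝ) (hS : Sᵀ = S) (hR : Rᵀ = R) :
    K'ᵀ * R * K' + (A - B * K')ᵀ * S * (A - B * K') =
      Kᵀ * R * K + (A - B * K)ᵀ * S * (A - B * K) +
        ((K' - K)ᵀ * ((R + Bᵀ * S * B) * K - Bᵀ * S * A) +
          ((R + Bᵀ * S * B) * K - Bᵀ * S * A)ᵀ * (K' - K) +
          (K' - K)ᵀ * (R + Bᵀ * S * B) * (K' - K)) := by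
  simp only [Matrix.transpose_sub, Matrix.transpose_add, Matrix.transpose_mul,
    Matrix.transpose_transpose, hS, hR, Matrix.mul_add, Matrix.add_mul, Matrix.mul_sub,
    Matrix.sub_mul, Matrix.mul_assoc]
  abel

/-- the outer-loop cost difference identity at a single time step. -/
theorem LQGame.outer_cost_difference {m d n N : ℕ} (g : LQGame m d n N) (t : ℕ) (ht : t < N)
    (Pn Pn' : Matrix (Fin m) (Fin m) ℝ) (hPn : Pn.PosSemidef) (hPn' : Pn'.PosSemidef)
    (hH : (g.Rw t - (g.D t)ᵀ * Pn * g.D t).PosDef)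
    (hH' : (g.Rw t - (g.D t)ᵀ * Pn' * g.D t).PosDef)
    (Kt Kt' : Matrix (Fin d) (Fin m) ℝ) :
    let Ptil := Pn + Pn * g.D t * (g.Rw t - (g.D t)ᵀ * Pn * g.D t)⁻¹ * (g.D t)ᵀ * Pn
    let Ptil' := Pn' + Pn' * g.D t * (g.Rw t - (g.D t)ᵀ * Pn' * g.D t)⁻¹ * (g.D t)ᵀ * Pn'
    let Pt := g.Q t + Ktᵀ * g.Ru t * Kt + (g.A t - g.B t * Kt)ᵀ * Ptil * (g.A t - g.B t * Kt)
    let Pt' := g.Q t + Kt'ᵀ * g.Ru t * Kt' +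
      (g.A t - g.B t * Kt')ᵀ * Ptil' * (g.A t - g.B t * Kt')
    let L' := (-(g.Rw t) + (g.D t)ᵀ * Pn' * g.D t)⁻¹ *
      ((g.D t)ᵀ * Pn' * (g.A t - g.B t * Kt'))
    let F := (g.Ru t + (g.B t)ᵀ * Ptil * g.B t) * Kt - (g.B t)ᵀ * Ptil * g.A t
    let Acl := g.A t - g.B t * Kt' - g.D t * L'
    let Xi := -((g.Rw t - (g.D t)ᵀ * Pn * g.D t) * L') - (g.D t)ᵀ * Pn * (g.A t - g.B t * Kt')
    let R := (Kt' - Kt)ᵀ * F + Fᵀ * (Kt' - Kt) +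
      (Kt' - Kt)ᵀ * (g.Ru t + (g.B t)ᵀ * Ptil * g.B t) * (Kt' - Kt)
    Pt' - Pt = Aclᵀ * (Pn' - Pn) * Acl + R -
      Xiᵀ * (g.Rw t - (g.D t)ᵀ * Pn * g.D t)⁻¹ * Xi := by
  intro Ptil Ptil' Pt Pt' L' F Acl Xi R
  have hP : Pnᵀ = Pn := by simpa using hPn.isHermitian.eq
  have hP' : Pn'ᵀ = Pn' := by simpa using hPn'.isHermitian.eq
  have hRu : (g.Ru t)ᵀ = g.Ru t := by simpa using (g.hRu t ht).isHermitian.eq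
  have hHt : (g.Rw t - (g.D t)ᵀ * Pn * g.D t)ᵀ = g.Rw t - (g.D t)ᵀ * Pn * g.D t := by
    simpa using hH.isHermitian.eq
  have hPtil : Ptilᵀ = Ptil := by
    simp only [Ptil, Matrix.transpose_add, Matrix.transpose_mul, Matrix.transpose_nonsing_inv,
      Matrix.transpose_transpose, hHt, hP]
    simp only [Matrix.mul_assoc]
  have hdet : IsUnit (-(g.Rw t) + (g.D t)ᵀ * Pn' * g.D t).det := by
    rw [← Matrix.isUnit_iff_isUnit_det]
    simpa [neg_add_eq_sub] using hH'.isUnit.neg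
  have hstat : -((g.Rw t - (g.D t)ᵀ * Pn' * g.D t) * L') -
      (g.D t)ᵀ * Pn' * (g.A t - g.B t * Kt') = 0 := by
    have hL' : (-(g.Rw t) + (g.D t)ᵀ * Pn' * g.D t) * L' =
        (g.D t)ᵀ * Pn' * (g.A t - g.B t * Kt') :=
      Matrix.mul_nonsing_inv_cancel_left _ _ hdet
    rw [← hL', ← Matrix.neg_mul, neg_sub', neg_sub_neg, ← sub_eq_neg_add, sub_self]
  have hsq := LQGame.completion_of_squares Pn (g.A t - g.B t * Kt') (g.D t) (g.Rw t) L' hP hH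
  have hsq' := LQGame.completion_of_squares Pn' (g.A t - g.B t * Kt') (g.D t) (g.Rw t) L' hP' hH'
  rw [hstat, Matrix.mul_zero, add_zero] at hsq'
  have hexp := LQGame.control_cost_expansion (g.A t) Ptil (g.B t) (g.Ru t) Kt Kt' hPtil hRu
  change _ = Aclᵀ * Pn * Acl - L'ᵀ * g.Rw t * L' +
    Xiᵀ * (g.Rw t - (g.D t)ᵀ * Pn * g.D t)⁻¹ * Xi at hsq
  change _ = Aclᵀ * Pn' * Acl - L'ᵀ * g.Rw t * L' at hsq'
  change _ = _ + R at hexp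
  have hR : R = Kt'ᵀ * g.Ru t * Kt' + (Aclᵀ * Pn * Acl - L'ᵀ * g.Rw t * L' +
      Xiᵀ * (g.Rw t - (g.D t)ᵀ * Pn * g.D t)⁻¹ * Xi) -
      (Ktᵀ * g.Ru t * Kt + (g.A t - g.B t * Kt)ᵀ * Ptil * (g.A t - g.B t * Kt)) := by
    rw [← hsq, eq_sub_iff_add_eq, add_comm]
    exact hexp.symm
  rw [hR, Matrix.mul_sub Aclᵀ Pn' Pn, Matrix.sub_mul]
  simp only [Pt, Pt', Ptil', hsq']
  abel
end
end

section
/- (Implicit regularization for Gauss–Newton.) Let K⁰ ∈ 𝒦 and 0 < α ≤ 1. Define the Gauss–Newton iterates inductively by K^{k+1}_t := K^k_t − 2α (G^{K^k}_t)⁻¹ F^{K^k}_t for t ∈ {0,…,N−1} and k ≥ 0. Then every iterate is admissible, K^k ∈ 𝒦 for all k ≥ 0 (so all quantities are well defined); the Riccati matrices are monotonically non-increasing: P^{K^{k+1}}_t ⪯ P^{K^k}_t for all t and k; and, if in addition Assumption 2.4 holds, then P^{K^k}_t ⪰ P*_t for all t and k. -/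
open Matrix

noncomputable section

namespace LQGame

section MatrixAlgebra

variable {ι κ η : Type*} [Fintype ι] [Fintype κ] [Fintype η]

/-- The disturbance-corrected value matrix `P + P D (R - Dᵀ P D)⁻¹ Dᵀ P`. -/
def tilde [DecidableEq κ] (R : Matrix κ κ ℝ) (D : Matrix ι κ ℝ) (P : Matrix ι ι ℝ) :
    Matrix ι ι ℝ :=
  P + P * D * (R - Dᵀ * P * D)⁻¹ * Dᵀ * P

/-- The one-step cost matrix of the gain `K` with value matrix `T` at the next step. -/
def stepCost (Q A : Matrix ι ι ℝ) (R : Matrix κ κ ℝ) (B : Matrix ι κ ℝ) (T : Matrix ι ι ℝ)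
    (K : Matrix κ ι ℝ) : Matrix ι ι ℝ :=
  Q + Kᵀ * R * K + (A - B * K)ᵀ * T * (A - B * K)

theorem posSemidef_transpose_mul_mul_same {M : Matrix ι ι ℝ} (hM : M.PosSemidef)
    (X : Matrix ι κ ℝ) : (Xᵀ * M * X).PosSemidef := by
  simpa using hM.conjTranspose_mul_mul_same X

theorem posDef_sub_transpose_mul_mul_mono {R : Matrix κ κ ℝ} {D : Matrix ι κ ℝ}
    {P P' : Matrix ι ι ℝ} (hS : (R - Dᵀ * P * D).PosDef) (h : (P - P').PosSemidef) :
    (R - Dᵀ * P' * D).PosDef := by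
  have := hS.add_posSemidef (posSemidef_transpose_mul_mul_same h D)
  convert this using 1
  simp only [Matrix.mul_sub, Matrix.sub_mul]
  abel

theorem sub_inv_mul_transpose_mul_mul {ν : Type*} [DecidableEq κ] {H : Matrix κ κ ℝ} (hH : H.PosDef)
    (C X : Matrix κ ν ℝ) :
    (X - H⁻¹ * C)ᵀ * H * (X - H⁻¹ * C) = Xᵀ * H * X - Xᵀ * C - Cᵀ * X + Cᵀ * H⁻¹ * C := by
  have hu : IsUnit H.det := (Matrix.isUnit_iff_isUnit_det H).mp hH.isUnit
  have ht : Hᵀ = H := by simpa using hH.isHermitian.eq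
  simp only [Matrix.transpose_sub, Matrix.transpose_mul, Matrix.transpose_nonsing_inv, ht,
    Matrix.mul_sub, Matrix.sub_mul, Matrix.mul_assoc, Matrix.mul_nonsing_inv_cancel_left _ _ hu,
    Matrix.nonsing_inv_mul_cancel_left _ _ hu]
  abel

theorem tilde_sub_eq [DecidableEq ι] [DecidableEq κ] {R : Matrix κ κ ℝ} {D : Matrix ι κ ℝ}
    {P : Matrix ι ι ℝ} (hP : Pᵀ = P) (hS : (R - Dᵀ * P * D).PosDef) (L : Matrix κ ι ℝ) :
    tilde R D P - ((1 + D * L)ᵀ * P * (1 + D * L) - Lᵀ * R * L) =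
      (L - (R - Dᵀ * P * D)⁻¹ * (Dᵀ * P))ᵀ * (R - Dᵀ * P * D) *
        (L - (R - Dᵀ * P * D)⁻¹ * (Dᵀ * P)) := by
  rw [sub_inv_mul_transpose_mul_mul hS, tilde]
  generalize (R - Dᵀ * P * D)⁻¹ = J
  simp only [Matrix.transpose_add, Matrix.transpose_mul, Matrix.transpose_transpose,
    Matrix.transpose_one, hP, Matrix.mul_sub, Matrix.sub_mul, Matrix.mul_add, Matrix.add_mul,
    Matrix.mul_one, Matrix.one_mul, Matrix.mul_assoc]
  abel

theorem tilde_mono [DecidableEq ι] [DecidableEq κ] {R : Matrix κ κ ℝ} {D : Matrix ι κ ℝ}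
    {P P' : Matrix ι ι ℝ} (hP : Pᵀ = P) (hP' : P'ᵀ = P') (hS : (R - Dᵀ * P * D).PosDef)
    (h : (P - P').PosSemidef) : (tilde R D P - tilde R D P').PosSemidef := by
  have hS' := posDef_sub_transpose_mul_mul_mono hS h
  set L := (R - Dᵀ * P' * D)⁻¹ * (Dᵀ * P') with hL
  have e := tilde_sub_eq hP hS L
  have e' := tilde_sub_eq hP' hS' L
  rw [← hL, sub_self, Matrix.mul_zero, sub_eq_zero] at e'
  rw [e']
  have h1 := posSemidef_transpose_mul_mul_same hS.posSemidef (L - (R - Dᵀ * P * D)⁻¹ * (Dᵀ * P))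
  rw [← e] at h1
  convert h1.add (posSemidef_transpose_mul_mul_same h (1 + D * L)) using 1
  simp only [Matrix.mul_sub, Matrix.sub_mul]
  abel

theorem tilde_posSemidef [DecidableEq κ] {R : Matrix κ κ ℝ} {D : Matrix ι κ ℝ}
    {P : Matrix ι ι ℝ} (hP : P.PosSemidef) (hS : (R - Dᵀ * P * D).PosDef) :
    (tilde R D P).PosSemidef := by
  have ht : Pᵀ = P := by simpa using hP.isHermitian.eq
  convert hP.add (posSemidef_transpose_mul_mul_same hS.inv.posSemidef (Dᵀ * P)) using 1
  simp only [tilde, Matrix.transpose_mul, Matrix.transpose_transpose, ht, Matrix.mul_assoc]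

theorem stepCost_posSemidef {Q A : Matrix ι ι ℝ} {R : Matrix κ κ ℝ} {B : Matrix ι κ ℝ}
    {T : Matrix ι ι ℝ} (hQ : Q.PosSemidef) (hR : R.PosDef) (hT : T.PosSemidef)
    (K : Matrix κ ι ℝ) : (stepCost Q A R B T K).PosSemidef :=
  (hQ.add (posSemidef_transpose_mul_mul_same hR.posSemidef K)).add
    (posSemidef_transpose_mul_mul_same hT (A - B * K))

theorem stepCost_mono (Q A : Matrix ι ι ℝ) (R : Matrix κ κ ℝ) (B : Matrix ι κ ℝ)
    {T T' : Matrix ι ι ℝ} (h : (T - T').PosSemidef) (K : Matrix κ ι ℝ) :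
    (stepCost Q A R B T K - stepCost Q A R B T' K).PosSemidef := by
  convert posSemidef_transpose_mul_mul_same h (A - B * K) using 1
  rw [stepCost, stepCost, add_sub_add_left_eq_sub, ← Matrix.sub_mul, ← Matrix.mul_sub]

theorem stepCost_hessian_posDef {R : Matrix κ κ ℝ} (hR : R.PosDef) {T : Matrix ι ι ℝ}
    (hT : T.PosSemidef) (B : Matrix ι κ ℝ) : (R + Bᵀ * T * B).PosDef :=
  hR.add_posSemidef (posSemidef_transpose_mul_mul_same hT B)

theorem stepCost_eq_completed_square [DecidableEq κ] (Q A : Matrix ι ι ℝ) {R : Matrix κ κ ℝ}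
    (hR : R.PosDef) (B : Matrix ι κ ℝ) {T : Matrix ι ι ℝ} (hT : T.PosSemidef)
    (K : Matrix κ ι ℝ) :
    stepCost Q A R B T K =
      Q + Aᵀ * (T - T * B * (R + Bᵀ * T * B)⁻¹ * Bᵀ * T) * A +
        (K - (R + Bᵀ * T * B)⁻¹ * (Bᵀ * T * A))ᵀ * (R + Bᵀ * T * B) *
          (K - (R + Bᵀ * T * B)⁻¹ * (Bᵀ * T * A)) := by
  have ht : Tᵀ = T := by simpa using hT.isHermitian.eq
  rw [sub_inv_mul_transpose_mul_mul (stepCost_hessian_posDef hR hT B), stepCost]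
  generalize (R + Bᵀ * T * B)⁻¹ = J
  simp only [Matrix.transpose_sub, Matrix.transpose_mul, Matrix.transpose_transpose, ht,
    Matrix.mul_sub, Matrix.sub_mul, Matrix.mul_add, Matrix.add_mul, Matrix.mul_assoc]
  abel

theorem stepCost_gaussNewton_le [DecidableEq κ] (Q A : Matrix ι ι ℝ) {R : Matrix κ κ ℝ}
    (hR : R.PosDef) (B : Matrix ι κ ℝ) {T : Matrix ι ι ℝ} (hT : T.PosSemidef)
    (K : Matrix κ ι ℝ) {α : ℝ} (hα0 : 0 ≤ α) (hα : α ≤ 1) :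
    (stepCost Q A R B T K - stepCost Q A R B T (K - (2 * α) •
      ((R + Bᵀ * T * B)⁻¹ * ((R + Bᵀ * T * B) * K - Bᵀ * T * A)))).PosSemidef := by
  have hG := stepCost_hessian_posDef hR hT B
  have hu : IsUnit (R + Bᵀ * T * B).det := (Matrix.isUnit_iff_isUnit_det _).mp hG.isUnit
  rw [stepCost_eq_completed_square Q A hR B hT, stepCost_eq_completed_square Q A hR B hT,
    Matrix.mul_sub (R + Bᵀ * T * B)⁻¹, Matrix.nonsing_inv_mul_cancel_left _ _ hu]
  set X := K - (R + Bᵀ * T * B)⁻¹ * (Bᵀ * T * A) with hX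
  have hX' : K - (2 * α) • X - (R + Bᵀ * T * B)⁻¹ * (Bᵀ * T * A) = (1 - 2 * α) • X := by
    rw [sub_smul, one_smul, sub_right_comm]
  rw [hX', add_sub_add_left_eq_sub]
  convert (posSemidef_transpose_mul_mul_same hG.posSemidef X).smul
    (show (0 : ℝ) ≤ 4 * α * (1 - α) by nlinarith) using 1
  simp only [Matrix.transpose_smul, Matrix.smul_mul, Matrix.mul_smul, smul_smul]
  module

theorem tilde_mul_one_sub [DecidableEq ι] [DecidableEq κ] {R : Matrix κ κ ℝ} (hR : R.PosDef)
    {D : Matrix ι κ ℝ} {P : Matrix ι ι ℝ} (hS : (R - Dᵀ * P * D).PosDef) :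
    tilde R D P * (1 - D * R⁻¹ * Dᵀ * P) = P := by
  have huR : IsUnit R.det := (Matrix.isUnit_iff_isUnit_det _).mp hR.isUnit
  have huS : IsUnit (R - Dᵀ * P * D).det := (Matrix.isUnit_iff_isUnit_det _).mp hS.isUnit
  have key : (R - Dᵀ * P * D)⁻¹ * (Dᵀ * P * (1 - D * R⁻¹ * Dᵀ * P)) = R⁻¹ * (Dᵀ * P) := by
    rw [← Matrix.nonsing_inv_mul_cancel_left _ (R⁻¹ * (Dᵀ * P)) huS]
    congr 1
    simp only [Matrix.mul_sub, Matrix.sub_mul, Matrix.mul_one, Matrix.mul_assoc,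
      Matrix.mul_nonsing_inv_cancel_left _ _ huR]
  calc tilde R D P * (1 - D * R⁻¹ * Dᵀ * P)
      = P * (1 - D * R⁻¹ * Dᵀ * P) + P * D *
          ((R - Dᵀ * P * D)⁻¹ * (Dᵀ * P * (1 - D * R⁻¹ * Dᵀ * P))) := by
        simp only [tilde, Matrix.add_mul, Matrix.mul_assoc]
    _ = P := by
        rw [key]
        simp only [Matrix.mul_sub, Matrix.mul_one, Matrix.mul_assoc, sub_add_cancel]

/-- Minimizing over the gain after maximizing over the disturbance yields the game Riccati map. -/
theorem tilde_schur_eq_mul_inv [DecidableEq ι] [DecidableEq κ] [DecidableEq η]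
    {Ru : Matrix κ κ ℝ} (hRu : Ru.PosDef) {Rw : Matrix η η ℝ} (hRw : Rw.PosDef)
    {B : Matrix ι κ ℝ} {D : Matrix ι η ℝ} {P : Matrix ι ι ℝ} (hP : P.PosSemidef)
    (hS : (Rw - Dᵀ * P * D).PosDef)
    (hΛ : IsUnit (1 + (B * Ru⁻¹ * Bᵀ - D * Rw⁻¹ * Dᵀ) * P)) :
    tilde Rw D P - tilde Rw D P * B * (Ru + Bᵀ * tilde Rw D P * B)⁻¹ * Bᵀ * tilde Rw D P =
      P * (1 + (B * Ru⁻¹ * Bᵀ - D * Rw⁻¹ * Dᵀ) * P)⁻¹ := by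
  have hT := tilde_mul_one_sub hRw hS
  have hG := stepCost_hessian_posDef hRu (tilde_posSemidef hP hS) B
  generalize tilde Rw D P = T at hT hG
  have huR : IsUnit Ru.det := (Matrix.isUnit_iff_isUnit_det _).mp hRu.isUnit
  have huG : IsUnit (Ru + Bᵀ * T * B).det := (Matrix.isUnit_iff_isUnit_det _).mp hG.isUnit
  have key : T * B - T * B * (Ru + Bᵀ * T * B)⁻¹ * (Bᵀ * T * B) =
      T * B * (Ru + Bᵀ * T * B)⁻¹ * Ru := by
    rw [sub_eq_iff_eq_add, ← Matrix.mul_add, Matrix.nonsing_inv_mul_cancel_right _ _ huG]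
  have hmul : (T - T * B * (Ru + Bᵀ * T * B)⁻¹ * Bᵀ * T) *
      (1 + (B * Ru⁻¹ * Bᵀ - D * Rw⁻¹ * Dᵀ) * P) = P := by
    calc _ = T * (1 - D * Rw⁻¹ * Dᵀ * P)
          - T * B * (Ru + Bᵀ * T * B)⁻¹ * Bᵀ * (T * (1 - D * Rw⁻¹ * Dᵀ * P))
          + (T * B - T * B * (Ru + Bᵀ * T * B)⁻¹ * (Bᵀ * T * B)) * (Ru⁻¹ * (Bᵀ * P)) := by
          generalize (Ru + Bᵀ * T * B)⁻¹ = J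
          simp only [Matrix.mul_sub, Matrix.sub_mul, Matrix.mul_add, Matrix.mul_one,
            Matrix.mul_assoc]
          abel
      _ = P := by
          rw [key, hT]
          simp only [Matrix.mul_assoc, Matrix.mul_nonsing_inv_cancel_left _ _ huR,
            sub_add_cancel]
  have hcancel := Matrix.mul_nonsing_inv_cancel_right _
    (T - T * B * (Ru + Bᵀ * T * B)⁻¹ * Bᵀ * T) ((Matrix.isUnit_iff_isUnit_det _).mp hΛ)
  rw [hmul] at hcancel
  exact hcancel.symm

end MatrixAlgebra

variable {m d n N : ℕ}

theorem Pstar_terminal (g : LQGame m d n N) : g.Pstar N = g.QN := by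
  simp [Pstar, Pstaraux]

theorem Ptilde_eq (g : LQGame m d n N) (K : ℕ → Matrix (Fin d) (Fin m) ℝ) (t : ℕ) :
    g.Ptilde K t = tilde (g.Rw t) (g.D t) (g.PK K (t + 1)) := rfl

theorem PK_eq_stepCost (g : LQGame m d n N) (K : ℕ → Matrix (Fin d) (Fin m) ℝ) {t : ℕ}
    (ht : t < N) :
    g.PK K t = stepCost (g.Q t) (g.A t) (g.Ru t) (g.B t) (g.Ptilde K t) (K t) := by
  have h : N - t = (N - (t + 1)) + 1 := by omega
  have h' : N - ((N - (t + 1)) + 1) = t := by omega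
  rw [PK, h, PKaux, h']
  rfl

theorem Pstar_step (g : LQGame m d n N) {t : ℕ} (ht : t < N) :
    g.Pstar t = g.Q t + (g.A t)ᵀ * (g.Pstar (t + 1) * (g.LambdaStar t)⁻¹) * g.A t := by
  have h : N - t = (N - (t + 1)) + 1 := by omega
  have h' : N - ((N - (t + 1)) + 1) = t := by omega
  rw [Pstar, h, Pstaraux, h', ← Matrix.mul_assoc]
  rfl

theorem Admissible.posSemidef_PK {g : LQGame m d n N} {K : ℕ → Matrix (Fin d) (Fin m) ℝ}
    (hK : g.Admissible K) {t : ℕ} (ht : t ≤ N) : (g.PK K t).PosSemidef := by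
  induction ht using Nat.decreasingInduction with
  | self => exact g.PK_terminal K ▸ g.hQN
  | of_succ t ht ih =>
    rw [g.PK_eq_stepCost K ht]
    exact stepCost_posSemidef (g.hQ t ht) (g.hRu t ht) (tilde_posSemidef ih (hK t ht)) _

theorem Admissible.posSemidef_Ptilde {g : LQGame m d n N} {K : ℕ → Matrix (Fin d) (Fin m) ℝ}
    (hK : g.Admissible K) {t : ℕ} (ht : t < N) : (g.Ptilde K t).PosSemidef :=
  tilde_posSemidef (hK.posSemidef_PK ht) (hK t ht)

theorem Admissible.PK_gaussNewton_le {g : LQGame m d n N} {K K' : ℕ → Matrix (Fin d) (Fin m) ℝ}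
    (hK : g.Admissible K) {α : ℝ} (hα0 : 0 ≤ α) (hα : α ≤ 1)
    (hstep : ∀ t < N, K' t = K t - (2 * α) • ((g.Gmat K t)⁻¹ * g.Fmat K t)) {t : ℕ}
    (ht : t ≤ N) : (g.PK K' t).PosSemidef ∧ (g.PK K t - g.PK K' t).PosSemidef := by
  induction ht using Nat.decreasingInduction with
  | self =>
    rw [PK_terminal, PK_terminal, sub_self]
    exact ⟨g.hQN, Matrix.PosSemidef.zero⟩
  | of_succ t ht ih =>
    obtain ⟨hP', hle⟩ := ih
    have hS' := posDef_sub_transpose_mul_mul_mono (hK t ht) hle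
    have hP := hK.posSemidef_PK (Nat.succ_le_of_lt ht)
    have hT := tilde_mono (by simpa using hP.isHermitian.eq) (by simpa using hP'.isHermitian.eq)
      (hK t ht) hle
    rw [← Ptilde_eq, ← Ptilde_eq] at hT
    have hGN := stepCost_gaussNewton_le (g.Q t) (g.A t) (g.hRu t ht) (g.B t)
      (hK.posSemidef_Ptilde ht) (K t) hα0 hα
    rw [g.PK_eq_stepCost K ht, g.PK_eq_stepCost K' ht]
    refine ⟨stepCost_posSemidef (g.hQ t ht) (g.hRu t ht) (tilde_posSemidef hP' hS') _, ?_⟩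
    have hmono := stepCost_mono (g.Q t) (g.A t) (g.Ru t) (g.B t) hT (K' t)
    have hK' := hstep t ht
    rw [Gmat, Fmat] at hK'
    rw [← hK'] at hGN
    simpa using hGN.add hmono

theorem Admissible.gaussNewton {g : LQGame m d n N} {K K' : ℕ → Matrix (Fin d) (Fin m) ℝ}
    (hK : g.Admissible K) {α : ℝ} (hα0 : 0 ≤ α) (hα : α ≤ 1)
    (hstep : ∀ t < N, K' t = K t - (2 * α) • ((g.Gmat K t)⁻¹ * g.Fmat K t)) :
    g.Admissible K' := fun t ht =>
  posDef_sub_transpose_mul_mul_mono (hK t ht) (hK.PK_gaussNewton_le hα0 hα hstep ht).2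

theorem Admissible.Pstar_le_PK {g : LQGame m d n N} {K : ℕ → Matrix (Fin d) (Fin m) ℝ}
    (hK : g.Admissible K) (hg : g.Assumption24) {t : ℕ} (ht : t ≤ N) :
    (g.PK K t - g.Pstar t).PosSemidef := by
  obtain ⟨hΛ, hpsd, hS⟩ := hg
  induction ht using Nat.decreasingInduction with
  | self =>
    rw [PK_terminal, Pstar_terminal, sub_self]
    exact Matrix.PosSemidef.zero
  | of_succ t ht ih =>
    have hP := hK.posSemidef_PK (Nat.succ_le_of_lt ht)
    have hPs := hpsd (t + 1) ht
    have hT := tilde_mono (by simpa using hP.isHermitian.eq) (by simpa using hPs.isHermitian.eq)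
      (hK t ht) ih
    have hTs := tilde_posSemidef hPs (hS t ht)
    have hmono := stepCost_mono (g.Q t) (g.A t) (g.Ru t) (g.B t) hT (K t)
    rw [stepCost_eq_completed_square (g.Q t) (g.A t) (g.hRu t ht) (g.B t) hTs (K t),
      tilde_schur_eq_mul_inv (g.hRu t ht) (g.hRw t ht) hPs (hS t ht) (hΛ t ht)] at hmono
    rw [g.PK_eq_stepCost K ht, g.Pstar_step ht]
    have hsq := posSemidef_transpose_mul_mul_same
      (stepCost_hessian_posDef (g.hRu t ht) hTs (g.B t)).posSemidef
      (K t - (g.Ru t + (g.B t)ᵀ * tilde (g.Rw t) (g.D t) (g.Pstar (t + 1)) * g.B t)⁻¹ *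
        ((g.B t)ᵀ * tilde (g.Rw t) (g.D t) (g.Pstar (t + 1)) * g.A t))
    convert hmono.add hsq using 1
    rw [← sub_sub _ (g.Q t + _), sub_add_cancel]
    rfl

end LQGame

/-- implicit regularization for the Gauss–Newton outer-loop updates. -/
theorem LQGame.gaussNewton_implicit_regularization {m d n N : ℕ} (g : LQGame m d n N)
    (hN : 0 < N) (K0 : ℕ → Matrix (Fin d) (Fin m) ℝ) (hK0 : g.Admissible K0)
    (α : ℝ) (hα0 : 0 < α) (hα : α ≤ 1)
    (Kseq : ℕ → ℕ → Matrix (Fin d) (Fin m) ℝ) (hinit : Kseq 0 = K0)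
    (hstep : ∀ k : ℕ, ∀ t < N,
      Kseq (k+1) t = Kseq k t - (2 * α) • ((g.Gmat (Kseq k) t)⁻¹ * g.Fmat (Kseq k) t)) :
    (∀ k : ℕ, g.Admissible (Kseq k))
    ∧ (∀ k : ℕ, ∀ t ≤ N, (g.PK (Kseq k) t - g.PK (Kseq (k+1)) t).PosSemidef)
    ∧ (g.Assumption24 → ∀ k : ℕ, ∀ t ≤ N, (g.PK (Kseq k) t - g.Pstar t).PosSemidef) := by
  have hadm : ∀ k, g.Admissible (Kseq k) := by
    intro k
    induction k with
    | zero => exact hinit ▸ hK0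
    | succ k ih => exact ih.gaussNewton hα0.le hα (hstep k)
  exact ⟨hadm, fun k _ ht => ((hadm k).PK_gaussNewton_le hα0.le hα (hstep k) ht).2,
    fun hg k _ ht => (hadm k).Pstar_le_PK hg ht⟩
end
end
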